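/- Let K ⊆ V ⊗ k be a strictly characteristic subspace with normalized generator e of l_K and structure constants a_i = ⟨e, φ^{σ₀+i}(e)⟩ (1 ≤ i ≤ σ₀ − 1), and let m be the largest positive divisor of σ₀ such that σ₀/m is odd and a_i = 0 for every 1 ≤ i ≤ σ₀ − 1 not divisible by 2m, with m = 0 if no such divisor exists. Then the number of orbits of the action of O_K(V) on I(V) equals (p^{σ₀}+1)(p^{σ₀−1}−1)/(p^m+1). -/

import Mathlib

open TensorProduct

noncomputable section

variable (p : ℕ) [Fact p.Prime] (k : Type) [Field k] [CharP k p] [Algebra (ZMod p) k]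

/-- The `p`-power (Frobenius) map on `k` as a `ZMod p`-linear map. -/
def frobLin : k →ₗ[ZMod p] k where
  toFun a := a ^ p
  map_add' a b := add_pow_char a b p
  map_smul' c a := by
    simp only [RingHom.id_apply]
    rw [Algebra.smul_def, Algebra.smul_def, mul_pow, ← map_pow, ZMod.pow_card]

variable (V : Type) [AddCommGroup V] [Module (ZMod p) V]

/-- The Frobenius-semilinear endomorphism `φ = id_V ⊗ (λ ↦ λ^p)` of `k ⊗[𝔽_p] V`. -/
def frobT : (k ⊗[ZMod p] V) →ₛₗ[frobenius k p] (k ⊗[ZMod p] V) where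
  toFun := LinearMap.rTensor V (frobLin p k)
  map_add' := map_add _
  map_smul' c x := by
    induction x using TensorProduct.induction_on with
    | zero => simp
    | tmul a v =>
        simp [smul_tmul', frobLin, frobenius_def, mul_pow]
    | add x y hx hy => simp_all [smul_add]

variable [IsAlgClosed k]

instance : RingHomSurjective (frobenius k p) := ⟨surjective_frobenius k p⟩

/-- The base change to `k` of the bilinear form `B`. -/
abbrev bcForm (B : LinearMap.BilinForm (ZMod p) V) :
    LinearMap.BilinForm k (k ⊗[ZMod p] V) :=
  LinearMap.BilinForm.baseChange k B

variable (σ₀ : ℕ) (B : LinearMap.BilinForm (ZMod p) V)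

/-- `K ⊆ V ⊗ k` is a characteristic subspace: totally isotropic of dimension `σ₀`,
and `K + φ(K)` has dimension `σ₀ + 1`. -/
def IsCharacteristicSub (K : Submodule k (k ⊗[ZMod p] V)) : Prop :=
  (∀ x ∈ K, ∀ y ∈ K, bcForm p k V B x y = 0) ∧
  Module.finrank k K = σ₀ ∧
  Module.finrank k ↥(K ⊔ Submodule.map (frobT p k V) K) = σ₀ + 1

/-- `K` is strictly characteristic if moreover `∑ᵢ φ^i(K) = V ⊗ k`. -/
def IsStrictlyCharacteristicSub (K : Submodule k (k ⊗[ZMod p] V)) : Prop :=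
  IsCharacteristicSub p k V σ₀ B K ∧
  (⨆ i : ℕ, (Submodule.map (frobT p k V))^[i] K) = ⊤

/-- `l_K = K ∩ φ(K) ∩ ⋯ ∩ φ^{σ₀ − 1}(K)`. -/
def lK (K : Submodule k (k ⊗[ZMod p] V)) : Submodule k (k ⊗[ZMod p] V) :=
  ⨅ i : Fin σ₀, (Submodule.map (frobT p k V))^[(i : ℕ)] K

/-- The group `O_K(V)` of isometries of `(V, B)` such that `g ⊗ k` maps `K` to itself. -/
def OK (K : Submodule k (k ⊗[ZMod p] V)) : Subgroup (V ≃ₗ[ZMod p] V) where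
  carrier := {g : V ≃ₗ[ZMod p] V | (∀ x y : V, B (g x) (g y) = B x y) ∧
    Submodule.map (LinearMap.baseChange k (g : V →ₗ[ZMod p] V)) K = K}
  one_mem' := by
    refine ⟨fun x y => rfl, ?_⟩
    rw [LinearEquiv.coe_toLinearMap_one, LinearMap.baseChange_id, Submodule.map_id]
  mul_mem' := by
    rintro g h ⟨hg1, hg2⟩ ⟨hh1, hh2⟩
    refine ⟨fun x y => (hg1 (h x) (h y)).trans (hh1 x y), ?_⟩
    have hco : ((g * h : V ≃ₗ[ZMod p] V) : V →ₗ[ZMod p] V)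
        = (g : V →ₗ[ZMod p] V).comp (h : V →ₗ[ZMod p] V) := rfl
    rw [hco, LinearMap.baseChange_comp, Submodule.map_comp, hh2, hg2]
  inv_mem' := by
    rintro g ⟨hg1, hg2⟩
    constructor
    · intro x y
      have h1 : g (g⁻¹ x) = x := g.apply_symm_apply x
      have h2 : g (g⁻¹ y) = y := g.apply_symm_apply y
      have := hg1 (g⁻¹ x) (g⁻¹ y)
      rw [h1, h2] at this
      exact this.symm
    · conv_lhs => rw [← hg2]
      rw [← Submodule.map_comp, ← LinearMap.baseChange_comp]
      have hco : ((g⁻¹ : V ≃ₗ[ZMod p] V) : V →ₗ[ZMod p] V).comp (g : V →ₗ[ZMod p] V)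
          = LinearMap.id := by
        ext x
        exact g.symm_apply_apply x
      rw [hco, LinearMap.baseChange_id, Submodule.map_id]

end

lemma exists_isotropic (p : ℕ) [Fact p.Prime] (V : Type) [AddCommGroup V] [Module (ZMod p) V]
    [Module.Finite (ZMod p) V] (B : LinearMap.BilinForm (ZMod p) V)
    (h3 : 2 < Module.finrank (ZMod p) V) : ∃ v : V, v ≠ 0 ∧ B v v = 0 := by
  classical
  let b := Module.finBasis (ZMod p) V
  let f : MvPolynomial (Fin (Module.finrank (ZMod p) V)) (ZMod p) :=
    ∑ i, ∑ j, MvPolynomial.C (B (b i) (b j)) * MvPolynomial.X i * MvPolynomial.X j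
  have hdeg : f.totalDegree ≤ 2 := by
    refine MvPolynomial.totalDegree_finsetSum_le (fun i _ => ?_)
    refine MvPolynomial.totalDegree_finsetSum_le (fun j _ => ?_)
    refine (MvPolynomial.totalDegree_mul _ _).trans ?_
    have h1 := MvPolynomial.totalDegree_mul (MvPolynomial.C (B (b i) (b j)))
      (MvPolynomial.X i : MvPolynomial (Fin (Module.finrank (ZMod p) V)) (ZMod p))
    simp only [MvPolynomial.totalDegree_C, MvPolynomial.totalDegree_X] at h1 ⊢
    omega
  have heval : ∀ x, MvPolynomial.eval x f = B (∑ i, x i • b i) (∑ i, x i • b i) := by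
    intro x
    simp only [f, map_sum, map_mul, MvPolynomial.eval_C, MvPolynomial.eval_X, LinearMap.sum_apply,
      map_smul, LinearMap.smul_apply, smul_eq_mul, Finset.mul_sum]
    rw [Finset.sum_comm]
    refine Finset.sum_congr rfl (fun i _ => Finset.sum_congr rfl (fun j _ => ?_))
    ring
  have hd := char_dvd_card_solutions p (f := f) (by simpa using lt_of_le_of_lt hdeg h3)
  have h0 : MvPolynomial.eval (0 : Fin (Module.finrank (ZMod p) V) → ZMod p) f = 0 := by
    rw [heval]; simp
  have hpos : 0 < Fintype.card {x // MvPolynomial.eval x f = 0} :=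
    Fintype.card_pos_iff.mpr ⟨⟨0, h0⟩⟩
  have h1 : 1 < Fintype.card {x // MvPolynomial.eval x f = 0} :=
    lt_of_lt_of_le (Fact.out : p.Prime).one_lt (Nat.le_of_dvd hpos hd)
  obtain ⟨⟨x, hx⟩, hne⟩ := Fintype.exists_ne_of_one_lt_card h1 ⟨0, h0⟩
  refine ⟨∑ i, x i • b i, ?_, by rw [← heval]; exact hx⟩
  intro hz
  apply hne
  have := Fintype.linearIndependent_iff.mp b.linearIndependent x hz
  ext i
  simpa using congrArg ZMod.val (this i)

lemma count_isotropic (p : ℕ) [Fact p.Prime] (hodd : Odd p) (n : ℕ) :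
    ∀ (V : Type) [AddCommGroup V] [Module (ZMod p) V]
    (_ : Module.finrank (ZMod p) V = 2 * (n + 1))
    (B : LinearMap.BilinForm (ZMod p) V)
    (_ : B.IsSymm) (_ : B.Nondegenerate)
    (_ : ∀ W : Submodule (ZMod p) V,
      (∀ x ∈ W, ∀ y ∈ W, B x y = 0) → Module.finrank (ZMod p) W ≠ n + 1),
    Nat.card {v : V // B v v = 0} + p ^ (n + 1) = p ^ (2 * n + 1) + p ^ n := by
  have h2 : (2 : ZMod p) ≠ 0 := by
    intro h
    have : (p : ℕ) ∣ 2 := (ZMod.natCast_eq_zero_iff 2 p).mp (by exact_mod_cast h)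
    have := (Nat.prime_dvd_prime_iff_eq Fact.out Nat.prime_two).mp this
    subst this
    exact absurd hodd (by decide)
  induction n with
  | zero =>
    intro V _ _ hdim B hsymm hnd hnn
    have : Nat.card {v : V // B v v = 0} = 1 := by
      rw [Nat.card_eq_one_iff_unique]
      refine ⟨⟨?_⟩, ⟨⟨0, by simp⟩⟩⟩
      have key : ∀ v : V, B v v = 0 → v = 0 := by
        intro v hv
        by_contra hne
        refine hnn (Submodule.span (ZMod p) {v}) ?_ (by simpa using finrank_span_singleton hne)
        intro x hx y hy
        obtain ⟨a, rfl⟩ := Submodule.mem_span_singleton.mp hx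
        obtain ⟨b, rfl⟩ := Submodule.mem_span_singleton.mp hy
        simp [hv]
      rintro ⟨a, ha⟩ ⟨b, hb⟩
      exact Subtype.ext ((key a ha).trans (key b hb).symm)
    rw [this]; ring
  | succ n ih =>
    intro V _ _ hdim B hsymm hnd hnn
    have hs : ∀ x y, B x y = B y x := fun x y => hsymm.eq y x ▸ rfl
    have : Module.Finite (ZMod p) V := Module.finite_of_finrank_pos (by omega)
    obtain ⟨v, hv0, hvv⟩ := exists_isotropic p V B (by omega)
    obtain ⟨w, hvw, hww⟩ : ∃ w, B v w = 1 ∧ B w w = 0 := by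
      obtain ⟨w, hw⟩ : ∃ w, B v w ≠ 0 := by
        by_contra hcon
        push Not at hcon
        exact hv0 (hnd.1 v hcon)
      set w1 := (B v w)⁻¹ • w with hw1
      have e1 : B v w1 = 1 := by simp [hw1, hw]
      refine ⟨w1 - (B w1 w1 / 2) • v, by simp [e1, hvv], ?_⟩
      have e2 : B w1 v = 1 := by rw [hs, e1]
      simp [e1, e2, hvv]
      field_simp
      ring
    have hwv : B w v = 1 := by rw [hs, hvw]
    let W : Submodule (ZMod p) V := LinearMap.ker (B v) ⊓ LinearMap.ker (B w)
    have hW : ∀ x : W, B v x = 0 ∧ B w x = 0 := fun x => by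
      exact ⟨LinearMap.mem_ker.mp x.2.1, LinearMap.mem_ker.mp x.2.2⟩
    have hW' : ∀ x : W, B x v = 0 ∧ B x w = 0 := fun x => by
      rw [hs _ v, hs _ w]; exact hW x
    let Φ : (ZMod p × ZMod p × W) →ₗ[ZMod p] V :=
      LinearMap.coprod (LinearMap.toSpanSingleton (ZMod p) V v)
        (LinearMap.coprod (LinearMap.toSpanSingleton (ZMod p) V w) W.subtype)
    have hΦ : ∀ a b x, Φ (a, b, x) = a • v + (b • w + (x : V)) := by
      intro a b x; simp [Φ]
    have hΦbij : Function.Bijective Φ := by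
      constructor
      · rw [← LinearMap.ker_eq_bot, LinearMap.ker_eq_bot']
        rintro ⟨a, b, x⟩ h
        rw [hΦ] at h
        have ha := congrArg (B w) h
        have hb := congrArg (B v) h
        simp [hww, hwv, hvv, hvw, hW x] at ha hb
        subst ha hb
        simpa using h
      · intro y
        refine ⟨(B w y, B v y, ⟨y - B w y • v - B v y • w, ?_⟩), ?_⟩
        · simp [W, hww, hwv, hvv, hvw]
        · rw [hΦ]; simp
    let Ψ := LinearEquiv.ofBijective Φ hΦbij
    have hdW : Module.finrank (ZMod p) W = 2 * (n + 1) := by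
      have := Ψ.finrank_eq
      simp only [Module.finrank_prod, Module.finrank_self] at this
      omega
    let BW : LinearMap.BilinForm (ZMod p) W := B.restrict W
    have hBW : ∀ x y, BW x y = B x y := fun x y => rfl
    have hsW : BW.IsSymm := ⟨fun x y => hs _ _⟩
    have hl : ∀ x : W, (∀ y : W, B x y = 0) → x = 0 := by
      intro x hx
      have : (x : V) = 0 := by
        apply hnd.1
        intro y
        obtain ⟨⟨a, b, z⟩, rfl⟩ := hΦbij.2 y
        rw [hΦ]
        simp [hW' x, hx z]
      exact_mod_cast this
    have hndW : BW.Nondegenerate := by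
      refine ⟨hl, ?_⟩
      intro x hx
      exact hl x (fun y => by rw [hs]; exact hx y)
    have hnnW : ∀ U : Submodule (ZMod p) W,
      (∀ x ∈ U, ∀ y ∈ U, BW x y = 0) → Module.finrank (ZMod p) U ≠ n + 1 := by
      intro U hU hUd
      let Θ : (ZMod p × U) →ₗ[ZMod p] V :=
        LinearMap.coprod (LinearMap.toSpanSingleton (ZMod p) V v) (W.subtype ∘ₗ U.subtype)
      have hΘ : ∀ a x, Θ (a, x) = a • v + ((x : W) : V) := by
        intro a x; simp [Θ]
      have hinj : Function.Injective Θ := by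
        rw [← LinearMap.ker_eq_bot, LinearMap.ker_eq_bot']
        rintro ⟨a, x⟩ h
        rw [hΘ] at h
        have ha := congrArg (B w) h
        simp [hwv, hW x.1] at ha
        subst ha
        simpa using h
      refine hnn (LinearMap.range Θ) ?_ ?_
      · rintro _ ⟨⟨a, x⟩, rfl⟩ _ ⟨⟨b, y⟩, rfl⟩
        rw [hΘ, hΘ]
        have := hU x x.2 y y.2
        rw [hBW] at this
        simp [hvv, hW, hW', this]
      · rw [LinearMap.finrank_range_of_inj hinj, Module.finrank_prod, hUd, Module.finrank_self]
        omega
    have IH := ih W hdW BW hsW hndW hnnW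
    have hq : ∀ a b x, B (Φ (a, b, x)) (Φ (a, b, x)) = 2 * a * b + BW x x := by
      intro a b x
      rw [hΦ, hBW]
      simp [hvv, hww, hvw, hwv, hW x, hW' x]
      ring
    have : Finite W := Module.finite_of_finite (ZMod p)
    have e : {y : V // B y y = 0} ≃ ({b : ZMod p // b ≠ 0} × W) ⊕ (ZMod p × {x : W // BW x x = 0}) := by
      refine Equiv.symm (Equiv.ofBijective (fun z => match z with
        | Sum.inl (b, x) => ⟨Φ (-(BW x x) / (2 * b.1), b.1, x), ?_⟩
        | Sum.inr (a, x) => ⟨Φ (a, 0, x.1), ?_⟩) ⟨?_, ?_⟩)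
      · rw [hq]
        have := b.2
        field_simp
        ring
      · rw [hq, x.2]; simp
      · rintro (⟨b, x⟩ | ⟨a, x⟩) (⟨b', x'⟩ | ⟨a', x'⟩) h
        · have := hΦbij.1 (congrArg Subtype.val h)
          simp only [Prod.mk.injEq] at this
          have h1 := Subtype.ext this.2.1
          rw [h1, this.2.2]
        · have := hΦbij.1 (congrArg Subtype.val h)
          simp only [Prod.mk.injEq] at this
          exact absurd this.2.1 b.2
        · have := hΦbij.1 (congrArg Subtype.val h)
          simp only [Prod.mk.injEq] at this
          exact absurd this.2.1.symm b'.2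
        · have := hΦbij.1 (congrArg Subtype.val h)
          simp only [Prod.mk.injEq] at this
          have h1 := Subtype.ext this.2.2
          rw [h1, this.1]
      · rintro ⟨y, hy⟩
        obtain ⟨⟨a, b, x⟩, rfl⟩ := hΦbij.2 y
        rw [hq] at hy
        by_cases hb : b = 0
        · subst hb
          exact ⟨Sum.inr (a, ⟨x, by simpa using hy⟩), rfl⟩
        · refine ⟨Sum.inl (⟨b, hb⟩, x), ?_⟩
          apply Subtype.ext
          show Φ _ = Φ _
          congr 2
          field_simp
          linear_combination -hy
    rw [Nat.card_congr e, Nat.card_sum, Nat.card_prod, Nat.card_prod, Nat.card_zmod]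
    have c1 : Nat.card {b : ZMod p // b ≠ 0} = p - 1 := by
      rw [Nat.card_eq_fintype_card, Fintype.card_subtype_compl, ZMod.card]
      simp
    have c2 : Nat.card W = p ^ (2 * (n + 1)) := by
      rw [Module.natCard_eq_pow_finrank (K := ZMod p), Nat.card_zmod, hdW]
    rw [c1, c2]
    obtain ⟨q, rfl⟩ : ∃ q, p = q + 1 := ⟨p - 1, by have := (Fact.out : p.Prime).pos; omega⟩
    simp only [Nat.add_sub_cancel]
    have IH' := congrArg (fun t => (q + 1) * t) IH
    simp only [mul_add] at IH'
    ring_nf at IH' ⊢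
    nlinarith [IH']

/-- The set of scalars through which `O_K(V)` acts on `l_K`. -/
def scalarSet (p σ₀ : ℕ) (k : Type) [Field k] (a : ℕ → k) : Set k :=
  {l | l ^ (p ^ σ₀ + 1) = 1 ∧ ∀ i : ℕ, 1 ≤ i → i ≤ σ₀ - 1 → a i ≠ 0 → l ^ p ^ i = l}

lemma pow_period {p : ℕ} {k : Type} [Field k] {l : k} {d : ℕ} (h : l ^ p ^ d = l) (s j : ℕ) :
    l ^ p ^ (s + d * j) = l ^ p ^ s := by
  induction j with
  | zero => simp
  | succ j ih =>
    have : s + d * (j + 1) = d + (s + d * j) := by ring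
    rw [this, pow_add, pow_mul, h, ih]

lemma scalarSet_eq (p : ℕ) [Fact p.Prime] (hodd : Odd p)
    (k : Type) [Field k] [CharP k p] (σ₀ : ℕ) (hσ : 1 ≤ σ₀) (a : ℕ → k) (m : ℕ)
    (hm : m = sSup {m' : ℕ | 0 < m' ∧ m' ∣ σ₀ ∧ Odd (σ₀ / m') ∧
      ∀ i : ℕ, 1 ≤ i → i ≤ σ₀ - 1 → ¬ (2 * m' ∣ i) → a i = 0}) :
    scalarSet p σ₀ k a = {l | l ^ (p ^ m + 1) = 1} := by
  set M := {m' : ℕ | 0 < m' ∧ m' ∣ σ₀ ∧ Odd (σ₀ / m') ∧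
      ∀ i : ℕ, 1 ≤ i → i ≤ σ₀ - 1 → ¬ (2 * m' ∣ i) → a i = 0} with hM
  have hbdd : BddAbove M := ⟨σ₀, fun x hx => Nat.le_of_dvd hσ hx.2.1⟩
  have hmem : M.Nonempty → m ∈ M := fun h => hm ▸ Nat.sSup_mem h hbdd
  have hodd_odd : ∀ n, Odd (p ^ n) := fun n => hodd.pow
  have hsq : ∀ (l : k), l ^ 2 = 1 → ∀ n, l ^ (p ^ n + 1) = 1 := by
    intro l hl n
    obtain ⟨t, ht⟩ := hodd_odd n
    rw [ht, show 2 * t + 1 + 1 = 2 * (t + 1) by ring, pow_mul, hl, one_pow]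
  have hsplit : ∀ m' ∈ M, ∃ j, σ₀ = m' + 2 * m' * j := by
    intro m' h
    obtain ⟨h0, ⟨q, rfl⟩, h2, h3⟩ := h
    rw [Nat.mul_div_cancel_left _ h0] at h2
    obtain ⟨j, rfl⟩ := h2
    exact ⟨j, by ring⟩
  ext l
  simp only [scalarSet, Set.mem_ofPred_eq]
  constructor
  · rintro ⟨h1, h2⟩
    have hl0 : l ≠ 0 := by rintro rfl; simp at h1
    have hfr : ∀ n, (frobenius k p)^[n] l = l ^ p ^ n := fun n => by simp [iterate_frobenius]
    set d := Function.minimalPeriod (frobenius k p) l with hd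
    have hdd : ∀ n, d ∣ n ↔ l ^ p ^ n = l := by
      intro n
      rw [← hfr, hd, ← Function.isPeriodicPt_iff_minimalPeriod_dvd]
      rfl
    have h2σ : d ∣ 2 * σ₀ := by
      rw [hdd, two_mul, pow_add, pow_mul]
      have hinv : l ^ p ^ σ₀ = l⁻¹ := by
        rw [pow_succ] at h1
        exact eq_inv_of_mul_eq_one_left h1
      rw [hinv, inv_pow, hinv, inv_inv]
    by_cases hdσ : d ∣ σ₀
    · rw [hdd] at hdσ
      apply hsq
      rw [pow_succ, hdσ] at h1
      rw [sq, h1]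
    · have hev : ∃ m', d = 2 * m' := by
        rcases Nat.even_or_odd d with he | ho
        · obtain ⟨t, ht⟩ := he
          exact ⟨t, by omega⟩
        · exact absurd ((Nat.Coprime.dvd_mul_left
            (Nat.coprime_two_right.mpr ho)).mp h2σ) hdσ
      obtain ⟨m', hm'⟩ := hev
      rw [hm'] at h2σ hdσ hdd
      have hdv : m' ∣ σ₀ := Nat.dvd_of_mul_dvd_mul_left (by norm_num) h2σ
      have hm'0 : 0 < m' := Nat.pos_of_dvd_of_pos hdv hσ
      have hm'M : m' ∈ M := by
        refine ⟨hm'0, hdv, ?_, ?_⟩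
        · obtain ⟨q, rfl⟩ := hdv
          rw [Nat.mul_div_cancel_left _ hm'0]
          by_contra hq
          rw [Nat.not_odd_iff_even] at hq
          obtain ⟨t, ht⟩ := hq
          exact hdσ ⟨t, by rw [ht]; ring⟩
        · intro i hi1 hi2 hi3
          by_contra hne
          exact hi3 ((hdd i).mpr (h2 i hi1 hi2 hne))
      have hmM := hmem ⟨m', hm'M⟩
      have hL : Nat.lcm m' m ∈ M := by
        have hdvL : Nat.lcm m' m ∣ σ₀ := Nat.lcm_dvd hdv hmM.2.1
        refine ⟨Nat.pos_of_dvd_of_pos hdvL hσ, hdvL, ?_, ?_⟩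
        · exact Odd.of_dvd_nat hm'M.2.2.1 (Nat.div_dvd_div_left hdvL (Nat.dvd_lcm_left _ _))
        · intro i hi1 hi2 hi3
          by_contra hne
          apply hi3
          rw [← Nat.lcm_mul_left]
          apply Nat.lcm_dvd
          · by_contra h; exact hne (hm'M.2.2.2 i hi1 hi2 h)
          · by_contra h; exact hne (hmM.2.2.2 i hi1 hi2 h)
      have hle : Nat.lcm m' m ≤ m := (le_csSup hbdd hL).trans hm.ge
      have heq : Nat.lcm m' m = m :=
        le_antisymm hle (Nat.le_of_dvd hL.1 (Nat.dvd_lcm_right _ _))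
      have hdm : m' ∣ m := heq ▸ Nat.dvd_lcm_left m' m
      have hper : l ^ p ^ (2 * m) = l := (hdd _).mp (Nat.mul_dvd_mul_left 2 hdm)
      obtain ⟨j, hj⟩ := hsplit m hmM
      have := pow_period hper m j
      rw [← hj] at this
      rw [pow_succ, ← this, ← pow_succ, h1]
  · intro h
    rcases M.eq_empty_or_nonempty with he | hne
    · have hm0 : m = 0 := by rw [hm, he]; simp
      subst hm0
      have h2 : l ^ 2 = 1 := by simpa using h
      refine ⟨hsq l h2 _, fun i _ _ _ => ?_⟩
      have hl0 : l ≠ 0 := by rintro rfl; simp at h2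
      have := hsq l h2 i
      rw [pow_succ] at this
      apply mul_right_cancel₀ hl0
      rw [this, ← sq, h2]
    · have hmM := hmem hne
      have hl0 : l ≠ 0 := by rintro rfl; simp at h
      have hinv : l ^ p ^ m = l⁻¹ := by
        rw [pow_succ] at h
        exact eq_inv_of_mul_eq_one_left h
      have hper : l ^ p ^ (2 * m) = l := by
        rw [two_mul, pow_add, pow_mul, hinv, inv_pow, hinv, inv_inv]
      obtain ⟨j, hj⟩ := hsplit m hmM
      have hp := pow_period hper m j
      rw [← hj] at hp
      refine ⟨by rw [pow_succ, hp, ← pow_succ, h], fun i hi1 hi2 hne => ?_⟩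
      have : 2 * m ∣ i := by
        by_contra hc; exact hne (hmM.2.2.2 i hi1 hi2 hc)
      obtain ⟨j, rfl⟩ := this
      simpa using pow_period hper 0 j

lemma card_scalarSet (p : ℕ) [Fact p.Prime] (hodd : Odd p)
    (k : Type) [Field k] [CharP k p] [IsAlgClosed k] (m : ℕ) :
    Nat.card {l : k | l ^ (p ^ m + 1) = 1} = p ^ m + 1 := by
  have hne : ((p ^ m + 1 : ℕ) : k) ≠ 0 := by
    rw [Ne, CharP.cast_eq_zero_iff k p]
    intro h
    rcases Nat.eq_zero_or_pos m with rfl | hm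
    · have := (Nat.prime_dvd_prime_iff_eq Fact.out Nat.prime_two).mp (by simpa using h)
      subst this
      exact absurd hodd (by decide)
    · have h1 : p ∣ 1 := (Nat.dvd_add_right (dvd_pow_self p hm.ne')).mp h
      exact (Fact.out : p.Prime).one_lt.ne' (Nat.dvd_one.mp h1)
  have : NeZero ((p ^ m + 1 : ℕ) : k) := ⟨hne⟩
  have : NeZero (p ^ m + 1) := ⟨by omega⟩
  have := HasEnoughRootsOfUnity.natCard_rootsOfUnity k (p ^ m + 1)
  refine Eq.trans ?_ this
  refine Nat.card_congr (Equiv.symm (Equiv.ofBijective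
    (fun z => ⟨((z : kˣ) : k), ?_⟩) ⟨?_, ?_⟩))
  · have := z.2
    rw [mem_rootsOfUnity] at this
    simpa using congrArg Units.val this
  · intro x y h
    exact Subtype.ext (Units.ext (congrArg Subtype.val h))
  · rintro ⟨l, hl⟩
    have hl : l ^ (p ^ m + 1) = 1 := hl
    have hl0 : l ≠ 0 := by rintro rfl; simp at hl
    exact ⟨⟨Units.mk0 l hl0, by rw [mem_rootsOfUnity]; ext; simpa using hl⟩, rfl⟩

section FrobeniusStructure

set_option linter.unusedSectionVars false

variable (p : ℕ) [Fact p.Prime] (k : Type) [Field k] [CharP k p] [Algebra (ZMod p) k]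
variable (V : Type) [AddCommGroup V] [Module (ZMod p) V]

lemma frobT_tmul (a : k) (v : V) : frobT p k V (a ⊗ₜ[ZMod p] v) = (a ^ p) ⊗ₜ[ZMod p] v := rfl

lemma frobT_form (B : LinearMap.BilinForm (ZMod p) V) (x y : k ⊗[ZMod p] V) :
    LinearMap.BilinForm.baseChange k B (frobT p k V x) (frobT p k V y) =
      (LinearMap.BilinForm.baseChange k B x y) ^ p := by
  induction x using TensorProduct.induction_on with
  | zero => simp [(Fact.out : p.Prime).ne_zero]
  | add x x' hx hx' => simp only [map_add, LinearMap.add_apply, hx, hx', add_pow_char]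
  | tmul a v =>
    induction y using TensorProduct.induction_on with
    | zero => simp [(Fact.out : p.Prime).ne_zero]
    | add x x' hx hx' => simp only [map_add, hx, hx', add_pow_char]
    | tmul b w =>
      rw [frobT_tmul, frobT_tmul, LinearMap.BilinForm.baseChange_tmul,
        LinearMap.BilinForm.baseChange_tmul, Algebra.smul_def, Algebra.smul_def, mul_pow,
        mul_pow, ← map_pow, ZMod.pow_card]

lemma frobT_iter_form (B : LinearMap.BilinForm (ZMod p) V) (n : ℕ) (x y : k ⊗[ZMod p] V) :
    LinearMap.BilinForm.baseChange k B ((frobT p k V)^[n] x) ((frobT p k V)^[n] y) =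
      (LinearMap.BilinForm.baseChange k B x y) ^ p ^ n := by
  induction n with
  | zero => simp
  | succ n ih =>
    rw [Function.iterate_succ_apply', Function.iterate_succ_apply', frobT_form, ih, ← pow_mul,
      pow_succ]

lemma frobT_iter_smul (n : ℕ) (c : k) (x : k ⊗[ZMod p] V) :
    (frobT p k V)^[n] (c • x) = (c ^ p ^ n) • (frobT p k V)^[n] x := by
  induction n with
  | zero => simp
  | succ n ih =>
    rw [Function.iterate_succ_apply', Function.iterate_succ_apply', ih, LinearMap.map_smulₛₗ,
      frobenius_def, ← pow_mul, pow_succ]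

lemma frobT_repr {ι : Type} (b : Module.Basis ι (ZMod p) V) (x : k ⊗[ZMod p] V) (i : ι) :
    (b.baseChange k).repr (frobT p k V x) i = ((b.baseChange k).repr x i) ^ p := by
  induction x using TensorProduct.induction_on with
  | zero => simp [(Fact.out : p.Prime).ne_zero]
  | add x x' hx hx' => simp only [map_add, Finsupp.add_apply, hx, hx', add_pow_char]
  | tmul a v =>
    rw [frobT_tmul, Module.Basis.baseChange_repr_tmul, Module.Basis.baseChange_repr_tmul,
      Algebra.smul_def, Algebra.smul_def, mul_pow, ← map_pow, ZMod.pow_card]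

lemma frobT_injective : Function.Injective (frobT p k V) := by
  intro x y h
  let b := Module.Basis.ofVectorSpace (ZMod p) V
  apply (b.baseChange k).repr.injective
  ext i
  have := congrArg (fun z => (b.baseChange k).repr z i) h
  simp only [frobT_repr] at this
  exact frobenius_inj k p this

lemma one_tmul_injective {v w : V} (h : (1 : k) ⊗ₜ[ZMod p] v = 1 ⊗ₜ[ZMod p] w) : v = w := by
  let b := Module.Basis.ofVectorSpace (ZMod p) V
  apply b.repr.injective
  ext i
  have := congrArg (fun z => (b.baseChange k).repr z i) h
  simp only [Module.Basis.baseChange_repr_tmul, Algebra.smul_def, mul_one] at this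
  rw [(algebraMap (ZMod p) k).injective this]

lemma frobT_fixed [Module.Finite (ZMod p) V] (x : k ⊗[ZMod p] V) (h : frobT p k V x = x) :
    ∃ v : V, (1 : k) ⊗ₜ[ZMod p] v = x := by
  let b := Module.finBasis (ZMod p) V
  have : ∀ i, ∃ c : ZMod p, algebraMap (ZMod p) k c = (b.baseChange k).repr x i := by
    intro i
    have h1 := congrArg (fun z => (b.baseChange k).repr z i) h
    simp only [frobT_repr] at h1
    rw [← Subfield.mem_bot_iff_pow_eq_self] at h1
    have h2 : (⊥ : Subfield k) ≤ (algebraMap (ZMod p) k).fieldRange := bot_le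
    exact h2 h1
  choose c hc using this
  refine ⟨∑ i, c i • b i, ?_⟩
  apply (b.baseChange k).repr.injective
  ext i
  rw [Module.Basis.baseChange_repr_tmul, ← hc, Algebra.smul_def, mul_one]
  congr 1
  rw [b.repr_sum_self]

lemma frobT_comm (g : V →ₗ[ZMod p] V) (x : k ⊗[ZMod p] V) :
    LinearMap.baseChange k g (frobT p k V x) = frobT p k V (LinearMap.baseChange k g x) := by
  induction x using TensorProduct.induction_on with
  | zero => simp
  | add x x' hx hx' => simp only [map_add, hx, hx']
  | tmul a v => simp [frobT_tmul]

lemma frobT_iter_comm (g : V →ₗ[ZMod p] V) (n : ℕ) (x : k ⊗[ZMod p] V) :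
    LinearMap.baseChange k g ((frobT p k V)^[n] x) =
      (frobT p k V)^[n] (LinearMap.baseChange k g x) := by
  induction n with
  | zero => rfl
  | succ n ih =>
    rw [Function.iterate_succ_apply', Function.iterate_succ_apply', frobT_comm, ih]

lemma form_baseChange (B : LinearMap.BilinForm (ZMod p) V) (g : V →ₗ[ZMod p] V)
    (hg : ∀ x y, B (g x) (g y) = B x y) (x y : k ⊗[ZMod p] V) :
    LinearMap.BilinForm.baseChange k B (LinearMap.baseChange k g x) (LinearMap.baseChange k g y)
      = LinearMap.BilinForm.baseChange k B x y := by
  induction x using TensorProduct.induction_on with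
  | zero => simp
  | add x x' hx hx' => simp only [map_add, LinearMap.add_apply, hx, hx']
  | tmul a v =>
    induction y using TensorProduct.induction_on with
    | zero => simp
    | add x x' hx hx' => simp only [map_add, hx, hx']
    | tmul b w => simp [hg]

lemma mem_iterate_map [IsAlgClosed k] (K : Submodule k (k ⊗[ZMod p] V)) (n : ℕ)
    (x : k ⊗[ZMod p] V) :
    x ∈ (Submodule.map (frobT p k V))^[n] K ↔ ∃ y ∈ K, (frobT p k V)^[n] y = x := by
  induction n generalizing x with
  | zero => simp
  | succ n ih =>
    rw [Function.iterate_succ_apply', Submodule.mem_map]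
    constructor
    · rintro ⟨y, hy, rfl⟩
      obtain ⟨z, hz, rfl⟩ := (ih y).mp hy
      exact ⟨z, hz, Function.iterate_succ_apply' _ _ _⟩
    · rintro ⟨z, hz, rfl⟩
      exact ⟨_, (ih _).mpr ⟨z, hz, rfl⟩, (Function.iterate_succ_apply' _ _ _).symm⟩

lemma gram_indep {M : Type} [AddCommGroup M] [Module k M] (β : LinearMap.BilinForm k M)
    (hs : ∀ x y, β x y = β y x) (E : ℕ → M) (s : ℕ)
    (h0 : ∀ i j, i ≤ j → j < i + s → β (E i) (E j) = 0)
    (h1 : ∀ i, β (E i) (E (i + s)) = 1) (c : ℕ → k)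
    (hc : ∀ j, β (∑ i ∈ Finset.range (2 * s), c i • E i) (E j) = 0) :
    ∀ i < 2 * s, c i = 0 := by
  intro i
  induction i using Nat.strong_induction_on with
  | _ i ih =>
    intro hi
    have := hc (i + s)
    rw [map_sum, LinearMap.sum_apply, Finset.sum_eq_single i] at this
    · simpa [h1] using this
    · intro j hj hne
      rw [Finset.mem_range] at hj
      rw [map_smul, LinearMap.smul_apply]
      rcases lt_or_gt_of_ne hne with hlt | hgt
      · rw [ih j hlt hj, zero_smul]
      · rcases le_total j (i + s) with h | h
        · rw [h0 j (i + s) h (by omega), smul_zero]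
        · rw [hs, h0 (i + s) j h (by omega), smul_zero]
    · intro h
      exact absurd (Finset.mem_range.mpr hi) h

end FrobeniusStructure

section ScalarAction

set_option linter.unusedSectionVars false

variable {p : ℕ} [Fact p.Prime] {k : Type} [Field k] [CharP k p] [Algebra (ZMod p) k]
  [IsAlgClosed k] {V : Type} [AddCommGroup V] [Module (ZMod p) V]
  {σ₀ : ℕ} {B : LinearMap.BilinForm (ZMod p) V}

lemma bc_symm (hsymm : B.IsSymm) (x y : k ⊗[ZMod p] V) :
    bcForm p k V B x y = bcForm p k V B y x := by
  have hs : ∀ x y, B x y = B y x := fun x y => hsymm.eq y x ▸ rfl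
  induction x using TensorProduct.induction_on with
  | zero => simp
  | add x x' hx hx' => simp only [map_add, LinearMap.add_apply, hx, hx']
  | tmul a v =>
    induction y using TensorProduct.induction_on with
    | zero => simp
    | add x x' hx hx' => simp only [map_add, LinearMap.add_apply, hx, hx']
    | tmul b w =>
      simp only [LinearMap.BilinForm.baseChange_tmul]
      rw [hs v w, mul_comm]

lemma form_shift (e : k ⊗[ZMod p] V) (i d : ℕ) :
    bcForm p k V B ((frobT p k V)^[i] e) ((frobT p k V)^[i + d] e) =
      (bcForm p k V B e ((frobT p k V)^[d] e)) ^ p ^ i := by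
  rw [Function.iterate_add_apply, frobT_iter_form]

lemma form_e_zero {K : Submodule k (k ⊗[ZMod p] V)} (hiso : ∀ x ∈ K, ∀ y ∈ K, bcForm p k V B x y = 0)
    {e : k ⊗[ZMod p] V} (he : e ∈ lK p k V σ₀ K) (i : ℕ) (hi : i < σ₀) :
    bcForm p k V B e ((frobT p k V)^[i] e) = 0 := by
  have hmem : ∀ j : ℕ, j < σ₀ → ∃ y ∈ K, (frobT p k V)^[j] y = e := by
    intro j hj
    rw [← mem_iterate_map]
    exact (Submodule.mem_iInf _).mp he ⟨j, hj⟩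
  obtain ⟨y, hy, hye⟩ := hmem i hi
  obtain ⟨z, hz, hze⟩ := hmem 0 (by omega)
  rw [Function.iterate_zero_apply] at hze
  subst hze
  conv_lhs => rw [← hye]
  rw [frobT_iter_form]
  rw [show ((LinearMap.BilinForm.baseChange k B y) ((frobT p k V)^[i] y) = 0) by
    rw [hye]; exact hiso _ hy _ hz]
  exact zero_pow (pow_ne_zero _ (Fact.out : p.Prime).ne_zero)

/-- Gram conditions on the vector `e`. -/
structure GoodVec (σ₀ : ℕ) (B : LinearMap.BilinForm (ZMod p) V) (e : k ⊗[ZMod p] V) : Prop where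
  symm : B.IsSymm
  pos : 1 ≤ σ₀
  dim : Module.finrank (ZMod p) V = 2 * σ₀
  zero : ∀ i < σ₀, bcForm p k V B e ((frobT p k V)^[i] e) = 0
  one : bcForm p k V B e ((frobT p k V)^[σ₀] e) = 1

lemma GoodVec.h0 {e : k ⊗[ZMod p] V} (h : GoodVec σ₀ B e) (i j : ℕ) (hij : i ≤ j)
    (hj : j < i + σ₀) :
    bcForm p k V B ((frobT p k V)^[i] e) ((frobT p k V)^[j] e) = 0 := by
  obtain ⟨d, rfl⟩ := Nat.exists_eq_add_of_le hij
  rw [form_shift, h.zero d (by omega)]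
  exact zero_pow (pow_ne_zero _ (Fact.out : p.Prime).ne_zero)

lemma GoodVec.h1 {e : k ⊗[ZMod p] V} (h : GoodVec σ₀ B e) (i : ℕ) :
    bcForm p k V B ((frobT p k V)^[i] e) ((frobT p k V)^[i + σ₀] e) = 1 := by
  rw [form_shift, h.one, one_pow]

lemma GoodVec.exists_basis {e : k ⊗[ZMod p] V} (h : GoodVec σ₀ B e) :
    ∃ b : Module.Basis (Fin (2 * σ₀)) k (k ⊗[ZMod p] V), ∀ i, b i = (frobT p k V)^[(i : ℕ)] e := by
  have hpos := h.pos
  have : Module.Finite (ZMod p) V := Module.finite_of_finrank_pos (by rw [h.dim]; omega)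
  have hli : LinearIndependent k (fun i : Fin (2 * σ₀) => (frobT p k V)^[(i : ℕ)] e) := by
    rw [Fintype.linearIndependent_iff]
    intro c hc i
    have := gram_indep k (bcForm p k V B) (bc_symm h.symm) (fun i => (frobT p k V)^[i] e) σ₀
      h.h0 h.h1 (fun i => if hi : i < 2 * σ₀ then c ⟨i, hi⟩ else 0) ?_ i i.2
    · simpa using this
    · intro j
      rw [Finset.sum_range]
      simp only [Fin.is_lt, dite_true, Fin.eta]
      rw [hc]; simp
  have : Nonempty (Fin (2 * σ₀)) := ⟨⟨0, by omega⟩⟩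
  refine ⟨basisOfLinearIndependentOfCardEqFinrank hli ?_, ?_⟩
  · rw [Module.finrank_baseChange, h.dim, Fintype.card_fin]
  · intro i; simp

lemma GoodVec.nondeg {e : k ⊗[ZMod p] V} (h : GoodVec σ₀ B e) (u : k ⊗[ZMod p] V)
    (hu : ∀ j < 2 * σ₀, bcForm p k V B u ((frobT p k V)^[j] e) = 0) : u = 0 := by
  obtain ⟨b, hb⟩ := h.exists_basis
  have hall : bcForm p k V B u = 0 := by
    apply b.ext
    intro i
    rw [hb, hu i i.2]; rfl
  have hexp := b.sum_repr u
  have := gram_indep k (bcForm p k V B) (bc_symm h.symm) (fun i => (frobT p k V)^[i] e) σ₀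
      h.h0 h.h1 (fun i => if hi : i < 2 * σ₀ then b.repr u ⟨i, hi⟩ else 0) ?_
  · rw [← hexp]
    refine Finset.sum_eq_zero (fun i _ => ?_)
    have := this i i.2
    simp only [Fin.is_lt, dite_true, Fin.eta] at this
    rw [this, zero_smul]
  · intro j
    rw [Finset.sum_range]
    simp only [Fin.is_lt, dite_true, Fin.eta]
    simp only [hb] at hexp
    rw [hexp, hall]; rfl

lemma eig_iter (g : V →ₗ[ZMod p] V) {e : k ⊗[ZMod p] V} {l : k}
    (hl : LinearMap.baseChange k g e = l • e) (n : ℕ) :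
    LinearMap.baseChange k g ((frobT p k V)^[n] e) = (l ^ p ^ n) • (frobT p k V)^[n] e := by
  rw [frobT_iter_comm, hl, frobT_iter_smul]

lemma OK_eig {K : Submodule k (k ⊗[ZMod p] V)} {e : k ⊗[ZMod p] V}
    (hgen : Submodule.span k {e} = lK p k V σ₀ K) (g : V ≃ₗ[ZMod p] V) (hg : g ∈ OK p k V B K) :
    ∃ l : k, LinearMap.baseChange k (g : V →ₗ[ZMod p] V) e = l • e := by
  have he : e ∈ lK p k V σ₀ K := hgen ▸ Submodule.mem_span_singleton_self e
  have : LinearMap.baseChange k (g : V →ₗ[ZMod p] V) e ∈ lK p k V σ₀ K := by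
    refine (Submodule.mem_iInf _).mpr (fun i => ?_)
    have h1 := (Submodule.mem_iInf _).mp he i
    rw [mem_iterate_map] at h1 ⊢
    obtain ⟨y, hy, hye⟩ := h1
    refine ⟨LinearMap.baseChange k (g : V →ₗ[ZMod p] V) y, ?_, ?_⟩
    · have := hg.2
      rw [← this]
      exact Submodule.mem_map_of_mem hy
    · rw [← frobT_iter_comm, hye]
  rw [← hgen, Submodule.mem_span_singleton] at this
  obtain ⟨l, hl⟩ := this
  exact ⟨l, hl.symm⟩

lemma GoodVec.scalar_mem {e : k ⊗[ZMod p] V} (h : GoodVec σ₀ B e) (g : V →ₗ[ZMod p] V)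
    (hg : ∀ x y, B (g x) (g y) = B x y) {l : k} (hl : LinearMap.baseChange k g e = l • e) :
    l ∈ scalarSet p σ₀ k (fun i => bcForm p k V B e ((frobT p k V)^[σ₀ + i] e)) := by
  have key : ∀ n, l * l ^ p ^ n * bcForm p k V B e ((frobT p k V)^[n] e) =
      bcForm p k V B e ((frobT p k V)^[n] e) := by
    intro n
    have := form_baseChange p k V B g hg e ((frobT p k V)^[n] e)
    rw [hl, eig_iter g hl] at this
    simp only [map_smul, LinearMap.smul_apply, smul_eq_mul] at this
    linear_combination this
  have h1 := key σ₀
  rw [h.one, mul_one] at h1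
  have hl0 : l ≠ 0 := by rintro rfl; simp at h1
  refine ⟨by rw [pow_succ, mul_comm]; exact h1, fun i _ _ hne => ?_⟩
  have h2 := mul_right_cancel₀ hne ((key (σ₀ + i)).trans (one_mul _).symm)
  have h3 := mul_left_cancel₀ hl0 (h2.trans h1.symm)
  rw [add_comm, pow_add, pow_mul] at h3
  exact iterateFrobenius_inj k p σ₀ (by simpa [iterateFrobenius_def] using h3)

lemma GoodVec.eig_unique {e : k ⊗[ZMod p] V} (h : GoodVec σ₀ B e) (g g' : V →ₗ[ZMod p] V)
    {l : k} (hl : LinearMap.baseChange k g e = l • e) (hl' : LinearMap.baseChange k g' e = l • e) :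
    g = g' := by
  obtain ⟨b, hb⟩ := h.exists_basis
  have : LinearMap.baseChange k g = LinearMap.baseChange k g' := by
    apply b.ext
    intro i
    rw [hb, eig_iter g hl, eig_iter g' hl']
  ext v
  apply one_tmul_injective p k V
  have := LinearMap.congr_fun this (1 ⊗ₜ[ZMod p] v)
  simpa using this

lemma GoodVec.free {e : k ⊗[ZMod p] V} (h : GoodVec σ₀ B e) (g : V →ₗ[ZMod p] V)
    {l : k} (hl : LinearMap.baseChange k g e = l • e) (v : V) (hv : v ≠ 0) (hgv : g v = v) :
    g = LinearMap.id := by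
  obtain ⟨b, hb⟩ := h.exists_basis
  let x : k ⊗[ZMod p] V := 1 ⊗ₜ[ZMod p] v
  have hx : x ≠ 0 := by
    intro hx
    apply hv
    apply one_tmul_injective p k V
    rw [TensorProduct.tmul_zero]; exact hx
  have hgx : LinearMap.baseChange k g x = x := by simp [x, hgv]
  have hrepr : ∀ (y : k ⊗[ZMod p] V) i,
      b.repr (LinearMap.baseChange k g y) i = l ^ p ^ (i : ℕ) * b.repr y i := by
    intro y i
    have : LinearMap.baseChange k g y = ∑ j : Fin (2 * σ₀), (l ^ p ^ (j : ℕ) * b.repr y j) • b j := by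
      conv_lhs => rw [← b.sum_repr y]
      rw [map_sum]
      refine Finset.sum_congr rfl (fun j _ => ?_)
      rw [map_smul, hb, eig_iter g hl, smul_smul, mul_comm]
    rw [this, b.repr_sum_self]
  have : ∃ i, b.repr x i ≠ 0 := by
    by_contra hcon
    push Not at hcon
    apply hx
    apply b.repr.injective
    ext i
    simp [hcon i]
  obtain ⟨i, hi⟩ := this
  have h1 := hrepr x i
  rw [hgx] at h1
  have h2 : l ^ p ^ (i : ℕ) = 1 := mul_right_cancel₀ hi (h1.symm.trans (one_mul _).symm)
  have h3 : l = 1 := by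
    apply iterateFrobenius_inj k p i
    simpa [iterateFrobenius_def] using h2
  subst h3
  exact h.eig_unique g LinearMap.id hl (by simp)

lemma GoodVec.exists_isom (hodd : Odd p) {e : k ⊗[ZMod p] V} (h : GoodVec σ₀ B e) {l : k}
    (hl : l ∈ scalarSet p σ₀ k (fun i => bcForm p k V B e ((frobT p k V)^[σ₀ + i] e))) :
    ∃ g : V ≃ₗ[ZMod p] V, (∀ x y, B (g x) (g y) = B x y) ∧
      LinearMap.baseChange k (g : V →ₗ[ZMod p] V) e = l • e := by
  have hpos := h.pos
  have : Module.Finite (ZMod p) V := Module.finite_of_finrank_pos (by rw [h.dim]; omega)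
  obtain ⟨hl1, hl2⟩ := hl
  have hl0 : l ≠ 0 := by rintro rfl; simp at hl1
  have h2 : (2 : k) ≠ 0 := by
    intro h
    have : (p : ℕ) ∣ 2 := (CharP.cast_eq_zero_iff k p 2).mp (by exact_mod_cast h)
    have := (Nat.prime_dvd_prime_iff_eq Fact.out Nat.prime_two).mp this
    subst this
    exact absurd hodd (by decide)
  obtain ⟨b, hb⟩ := h.exists_basis
  have hs := bc_symm (k := k) h.symm
  set E : ℕ → k ⊗[ZMod p] V := fun i => (frobT p k V)^[i] e with hE
  set β := bcForm p k V B with hβ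
  -- scaling is compatible with the Gram matrix
  have hgram0 : ∀ d < 2 * σ₀, l * l ^ p ^ d * β e (E d) = β e (E d) := by
    intro d hd
    rcases lt_trichotomy d σ₀ with hlt | rfl | hgt
    · rw [show β e (E d) = 0 from h.zero d hlt, mul_zero]
    · rw [mul_comm l, ← pow_succ, hl1, one_mul]
    · obtain ⟨i, rfl⟩ := Nat.exists_eq_add_of_lt hgt
      by_cases h0 : β e (E (σ₀ + i + 1)) = 0
      · rw [h0, mul_zero]
      · have := hl2 (i + 1) (by omega) (by omega) h0
        rw [show p ^ (σ₀ + i + 1) = p ^ (i + 1) * p ^ σ₀ by ring, pow_mul, this, mul_comm l,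
          ← pow_succ, hl1, one_mul]
  have hgram1 : ∀ i j, i ≤ j → j < i + 2 * σ₀ →
      l ^ p ^ i * l ^ p ^ j * β (E i) (E j) = β (E i) (E j) := by
    intro i j hij hj
    obtain ⟨d, rfl⟩ := Nat.exists_eq_add_of_le hij
    have := congrArg (fun t => t ^ p ^ i) (hgram0 d (by omega))
    simp only [mul_pow] at this
    rw [show β (E i) (E (i + d)) = _ from form_shift e i d]
    rw [show l ^ p ^ (i + d) = (l ^ p ^ d) ^ p ^ i by rw [← pow_mul]; ring]
    exact this
  have hgram : ∀ i j, i < j + 2 * σ₀ → j < i + 2 * σ₀ →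
      l ^ p ^ i * l ^ p ^ j * β (E i) (E j) = β (E i) (E j) := by
    intro i j hi hj
    rcases le_total i j with hij | hij
    · exact hgram1 i j hij hj
    · rw [hs, mul_comm (l ^ p ^ i)]; exact hgram1 j i hij hi
  let G : (k ⊗[ZMod p] V) →ₗ[k] (k ⊗[ZMod p] V) :=
    b.constr k (fun i => (l ^ p ^ (i : ℕ)) • E i)
  have hG : ∀ i < 2 * σ₀, G (E i) = (l ^ p ^ i) • E i := by
    intro i hi
    have := b.constr_basis k (fun i : Fin (2 * σ₀) => (l ^ p ^ (i : ℕ)) • E i) ⟨i, hi⟩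
    rw [hb] at this
    exact this
  have hiso : ∀ x y, β (G x) (G y) = β x y := by
    have : β.compl₁₂ G G = β := by
      apply b.ext
      intro i
      apply b.ext
      intro j
      rw [hb, hb, LinearMap.compl₁₂_apply]
      change β (G (E i)) (G (E j)) = β (E i) (E j)
      rw [hG i i.2, hG j j.2, map_smul, map_smul, LinearMap.smul_apply, smul_eq_mul, smul_eq_mul]
      have := hgram i j (by omega) (by omega)
      linear_combination this
    intro x y
    exact LinearMap.congr_fun (LinearMap.congr_fun this x) y
  have hG2 : G (E (2 * σ₀)) = (l ^ p ^ (2 * σ₀)) • E (2 * σ₀) := by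
    set u := G (E (2 * σ₀)) - (l ^ p ^ (2 * σ₀)) • E (2 * σ₀) with hu
    have hu1 : ∀ j, 1 ≤ j → j < 2 * σ₀ → β u (E j) = 0 := by
      intro j hj1 hj2
      have e1 := hiso (E (2 * σ₀)) (E j)
      rw [hG j hj2, map_smul, smul_eq_mul] at e1
      have e2 := hgram (2 * σ₀) j (by omega) (by omega)
      have hne : l ^ p ^ j ≠ 0 := pow_ne_zero _ hl0
      apply mul_left_cancel₀ hne
      rw [hu, map_sub, LinearMap.sub_apply, map_smul, LinearMap.smul_apply, smul_eq_mul]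
      linear_combination e1 - e2
    set c := β u e with hc
    have hu2 : u - c • E σ₀ = 0 := by
      apply h.nondeg
      intro j hj
      change β (u - c • E σ₀) (E j) = 0
      rw [map_sub, LinearMap.sub_apply, map_smul, LinearMap.smul_apply, smul_eq_mul]
      rcases Nat.eq_zero_or_pos j with rfl | hj0
      · have : β (E σ₀) (E 0) = 1 := by rw [hs]; exact h.one
        rw [this]
        simp [hc, hE]
      · rw [hu1 j hj0 hj]
        have : β (E σ₀) (E j) = 0 := by
          rcases le_total σ₀ j with hle | hle
          · exact h.h0 σ₀ j hle (by omega)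
          · rw [hs]; exact h.h0 j σ₀ hle (by omega)
        rw [this]; ring
    have hGE : G (E (2 * σ₀)) = (l ^ p ^ (2 * σ₀)) • E (2 * σ₀) + c • E σ₀ := by
      rw [← sub_eq_zero.mp hu2, hu]; abel
    have z1 : ∀ n, β (E n) (E n) = 0 := fun n => h.h0 n n le_rfl (by omega)
    have z2 : β (E σ₀) (E (2 * σ₀)) = 1 := by rw [two_mul]; exact h.h1 σ₀
    have z3 : β (E (2 * σ₀)) (E σ₀) = 1 := by rw [hs, z2]
    have hq := hiso (E (2 * σ₀)) (E (2 * σ₀))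
    rw [hGE] at hq
    simp only [map_add, map_smul, LinearMap.add_apply, LinearMap.smul_apply, smul_eq_mul, z1, z2,
      z3] at hq
    have hc0 : c = 0 := by
      have hne : 2 * l ^ p ^ (2 * σ₀) ≠ 0 := mul_ne_zero h2 (pow_ne_zero _ hl0)
      apply mul_left_cancel₀ hne
      linear_combination hq
    rw [hGE, hc0, zero_smul, add_zero]
  have hG' : ∀ i ≤ 2 * σ₀, G (E i) = (l ^ p ^ i) • E i := by
    intro i hi
    rcases Nat.lt_or_eq_of_le hi with hi | rfl
    · exact hG i hi
    · exact hG2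
  have hEs : ∀ i, frobT p k V (E i) = E (i + 1) := fun i =>
    (Function.iterate_succ_apply' _ _ _).symm
  have hcomm : ∀ x, G (frobT p k V x) = frobT p k V (G x) := by
    intro x
    rw [← b.sum_repr x]
    simp only [map_sum, map_smul, LinearMap.map_smulₛₗ]
    refine Finset.sum_congr rfl (fun i _ => ?_)
    congr 1
    rw [hb]
    change G (frobT p k V (E i)) = frobT p k V (G (E i))
    rw [hEs, hG' _ (by omega), hG i i.2, LinearMap.map_smulₛₗ, hEs, frobenius_def, ← pow_mul,
      pow_succ]
  have hfix : ∀ v : V, ∃ w : V, (1 : k) ⊗ₜ[ZMod p] w = G (1 ⊗ₜ[ZMod p] v) := by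
    intro v
    apply frobT_fixed
    rw [← hcomm, frobT_tmul, one_pow]
  choose γ hγ using hfix
  let γl : V →ₗ[ZMod p] V :=
    { toFun := γ
      map_add' := fun x y => by
        apply one_tmul_injective p k V
        rw [hγ, TensorProduct.tmul_add, TensorProduct.tmul_add, map_add, hγ, hγ]
      map_smul' := fun c x => by
        apply one_tmul_injective p k V
        rw [hγ, RingHom.id_apply, TensorProduct.tmul_smul, TensorProduct.tmul_smul, hγ,
          ← algebraMap_smul k c, ← algebraMap_smul k c, map_smul] }
  have hγG : LinearMap.baseChange k γl = G := by
    apply LinearMap.ext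
    intro x
    induction x using TensorProduct.induction_on with
    | zero => simp
    | add x y hx hy => rw [map_add, map_add, hx, hy]
    | tmul a v =>
      rw [LinearMap.baseChange_tmul]
      have h1 : ∀ w : V, a ⊗ₜ[ZMod p] w = a • ((1 : k) ⊗ₜ[ZMod p] w) := by
        intro w; rw [TensorProduct.smul_tmul', smul_eq_mul, mul_one]
      rw [h1 v, h1, map_smul]
      congr 1
      exact hγ v
  have hγB : ∀ x y, B (γl x) (γl y) = B x y := by
    intro x y
    have := hiso (1 ⊗ₜ[ZMod p] x) (1 ⊗ₜ[ZMod p] y)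
    rw [← hγG, LinearMap.baseChange_tmul, LinearMap.baseChange_tmul, hβ,
      LinearMap.BilinForm.baseChange_tmul, LinearMap.BilinForm.baseChange_tmul,
      Algebra.smul_def, Algebra.smul_def, mul_one, mul_one, mul_one] at this
    exact (algebraMap (ZMod p) k).injective this
  have hγinj : Function.Injective γl := by
    rw [← LinearMap.ker_eq_bot, LinearMap.ker_eq_bot']
    intro v hv
    have hz : (1 : k) ⊗ₜ[ZMod p] v = 0 := by
      apply h.nondeg
      intro j _
      change β _ (E j) = 0
      rw [← hiso, ← hγG, LinearMap.baseChange_tmul, hv]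
      simp
    apply one_tmul_injective p k V
    rw [hz, TensorProduct.tmul_zero]
  refine ⟨LinearEquiv.ofInjectiveEndo γl hγinj, fun x y => hγB x y, ?_⟩
  have hco : ((LinearEquiv.ofInjectiveEndo γl hγinj : V ≃ₗ[ZMod p] V) : V →ₗ[ZMod p] V) = γl := by
    ext x; rfl
  rw [hco, hγG]
  have := hG 0 (by omega)
  simpa [hE] using this

lemma GoodVec.mem_OK {e : k ⊗[ZMod p] V} (h : GoodVec σ₀ B e) {l : k}
    {K : Submodule k (k ⊗[ZMod p] V)} (hKd : Module.finrank k K = σ₀) (he : e ∈ lK p k V σ₀ K)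
    (g : V ≃ₗ[ZMod p] V) (hg : ∀ x y, B (g x) (g y) = B x y)
    (hl : LinearMap.baseChange k (g : V →ₗ[ZMod p] V) e = l • e) : g ∈ OK p k V B K := by
  refine ⟨hg, ?_⟩
  have hpos := h.pos
  have : Module.Finite (ZMod p) V := Module.finite_of_finrank_pos (by rw [h.dim]; omega)
  have hmem : ∀ j : ℕ, j < σ₀ → ∃ y ∈ K, (frobT p k V)^[j] y = e := by
    intro j hj
    rw [← mem_iterate_map]
    exact (Submodule.mem_iInf _).mp he ⟨j, hj⟩
  have hinj : ∀ n, Function.Injective (frobT p k V)^[n] := fun n => (frobT_injective p k V).iterate n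
  obtain ⟨f, hfK, hfe⟩ := hmem (σ₀ - 1) (by omega)
  have hfj : ∀ j < σ₀, (frobT p k V)^[j] f ∈ K := by
    intro j hj
    obtain ⟨y, hy, hye⟩ := hmem (σ₀ - 1 - j) (by omega)
    have : (frobT p k V)^[σ₀ - 1 - j] ((frobT p k V)^[j] f) = (frobT p k V)^[σ₀ - 1 - j] y := by
      rw [← Function.iterate_add_apply, hye, ← hfe]
      congr 2
      omega
    rw [hinj _ this]
    exact hy
  have hpw : ∀ i, (bcForm p k V B f ((frobT p k V)^[i] f)) ^ p ^ (σ₀ - 1) =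
      bcForm p k V B e ((frobT p k V)^[i] e) := by
    intro i
    rw [← frobT_iter_form, ← Function.iterate_add_apply, add_comm, Function.iterate_add_apply, hfe]
  have hgood : GoodVec σ₀ B f := by
    refine ⟨h.symm, h.pos, h.dim, ?_, ?_⟩
    · intro i hi
      have := hpw i
      rw [h.zero i hi] at this
      exact eq_zero_of_pow_eq_zero this
    · have := hpw σ₀
      rw [h.one] at this
      apply iterateFrobenius_inj k p (σ₀ - 1)
      simpa [iterateFrobenius_def] using this
  obtain ⟨b, hb⟩ := hgood.exists_basis
  have hli : LinearIndependent k (fun i : Fin σ₀ => (frobT p k V)^[(i : ℕ)] f) := by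
    have := b.linearIndependent.comp (Fin.castLE (by omega : σ₀ ≤ 2 * σ₀)) (Fin.castLE_injective _)
    convert this using 1
    ext i
    simp [hb]
  have hspan : Submodule.span k (Set.range (fun i : Fin σ₀ => (frobT p k V)^[(i : ℕ)] f)) = K := by
    apply Submodule.eq_of_le_of_finrank_eq
    · rw [Submodule.span_le]
      rintro _ ⟨i, rfl⟩
      exact hfj i i.2
    · rw [finrank_span_eq_card hli, hKd, Fintype.card_fin]
  obtain ⟨l', hl'⟩ := IsAlgClosed.exists_pow_nat_eq l
    (pow_pos (Fact.out : p.Prime).pos (σ₀ - 1))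
  have hGf : LinearMap.baseChange k (g : V →ₗ[ZMod p] V) f = l' • f := by
    apply hinj (σ₀ - 1)
    rw [← frobT_iter_comm, frobT_iter_smul, hfe, hl, hl']
  have hle : Submodule.map (LinearMap.baseChange k (g : V →ₗ[ZMod p] V)) K ≤ K := by
    conv_lhs => rw [← hspan]
    rw [Submodule.map_span_le]
    rintro _ ⟨i, rfl⟩
    rw [eig_iter _ hGf]
    exact K.smul_mem _ (hfj i i.2)
  apply Submodule.eq_of_le_of_finrank_eq hle
  exact LinearEquiv.finrank_map_eq (LinearEquiv.baseChange (ZMod p) k V V g) K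

lemma GoodVec.card_OK (hodd : Odd p) {e : k ⊗[ZMod p] V} (h : GoodVec σ₀ B e)
    {K : Submodule k (k ⊗[ZMod p] V)} (hKd : Module.finrank k K = σ₀)
    (hgen : Submodule.span k {e} = lK p k V σ₀ K) :
    Nat.card (OK p k V B K) =
      Nat.card (scalarSet p σ₀ k (fun i => bcForm p k V B e ((frobT p k V)^[σ₀ + i] e))) := by
  have he : e ∈ lK p k V σ₀ K := hgen ▸ Submodule.mem_span_singleton_self e
  have he0 : e ≠ 0 := by
    rintro rfl
    have := h.one
    simp at this
  have hex : ∀ g : OK p k V B K, ∃ l : k,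
      LinearMap.baseChange k ((g : V ≃ₗ[ZMod p] V) : V →ₗ[ZMod p] V) e = l • e :=
    fun g => OK_eig hgen g.1 g.2
  choose L hL using hex
  refine Nat.card_congr (Equiv.ofBijective
    (fun g => ⟨L g, h.scalar_mem _ g.2.1 (hL g)⟩) ⟨?_, ?_⟩)
  · intro g g' heq
    have hLL : L g = L g' := congrArg Subtype.val heq
    have := h.eig_unique _ _ (hL g) (hLL ▸ hL g')
    exact Subtype.ext (LinearEquiv.toLinearMap_injective this)
  · rintro ⟨l, hl⟩
    obtain ⟨g, hg, hge⟩ := h.exists_isom hodd hl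
    refine ⟨⟨g, h.mem_OK hKd he g hg hge⟩, ?_⟩
    apply Subtype.ext
    have := hL ⟨g, h.mem_OK hKd he g hg hge⟩
    exact smul_left_injective k he0 (this.symm.trans hge)

lemma card_orbits (G : Subgroup (V ≃ₗ[ZMod p] V)) (P : V → Prop)
    (hP : ∀ g ∈ G, ∀ v, P v → P (g v))
    (hfree : ∀ g ∈ G, ∀ v, P v → g v = v → g = 1) :
    Nat.card {s : Set V // ∃ v : V, P v ∧ s = {w : V | ∃ g ∈ G, g v = w}} * Nat.card G =
      Nat.card {v : V // P v} := by
  rw [← Nat.card_prod]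
  have hch : ∀ s : {s : Set V // ∃ v : V, P v ∧ s = {w : V | ∃ g ∈ G, g v = w}},
    ∃ v : V, P v ∧ s.1 = {w : V | ∃ g ∈ G, g v = w} := fun s => s.2
  choose r hr1 hr2 using hch
  refine Nat.card_congr (Equiv.ofBijective
    (fun z => ⟨z.2.1 (r z.1), hP _ z.2.2 _ (hr1 z.1)⟩) ⟨?_, ?_⟩)
  · rintro ⟨s, g, hg⟩ ⟨s', g', hg'⟩ heq
    have heq : g (r s) = g' (r s') := congrArg Subtype.val heq
    have hss : s = s' := by
      apply Subtype.ext
      rw [hr2 s, hr2 s']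
      ext w
      constructor
      · rintro ⟨x, hx, rfl⟩
        refine ⟨x * g⁻¹ * g', G.mul_mem (G.mul_mem hx (G.inv_mem hg)) hg', ?_⟩
        change x (g.symm (g' (r s'))) = _
        rw [← heq, g.symm_apply_apply]
      · rintro ⟨x, hx, rfl⟩
        refine ⟨x * g'⁻¹ * g, G.mul_mem (G.mul_mem hx (G.inv_mem hg')) hg, ?_⟩
        change x (g'.symm (g (r s))) = _
        rw [heq, g'.symm_apply_apply]
    subst hss
    have h1 : g'⁻¹ * g = 1 := by
      apply hfree _ (G.mul_mem (G.inv_mem hg') hg) (r s) (hr1 s)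
      change g'.symm (g (r s)) = _
      rw [heq, g'.symm_apply_apply]
    have : g = g' := (inv_mul_eq_one.mp h1).symm
    subst this
    rfl
  · rintro ⟨v, hv⟩
    let s : {s : Set V // ∃ v : V, P v ∧ s = {w : V | ∃ g ∈ G, g v = w}} := ⟨_, v, hv, rfl⟩
    have hvs : v ∈ s.1 := ⟨1, G.one_mem, rfl⟩
    rw [hr2 s] at hvs
    obtain ⟨g, hg, hgv⟩ := hvs
    exact ⟨⟨s, g, hg⟩, Subtype.ext hgv⟩

end ScalarAction

/-- the number of orbits of `O_K(V)` acting on the set `I(V)` of nonzero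
isotropic vectors of `V` equals `(p^σ₀ + 1)(p^(σ₀-1) - 1)/(p^m + 1)`. -/
theorem statement11
    (p : ℕ) [Fact p.Prime] (hodd : Odd p)
    (k : Type) [Field k] [CharP k p] [Algebra (ZMod p) k] [IsAlgClosed k]
    (V : Type) [AddCommGroup V] [Module (ZMod p) V]
    (σ₀ : ℕ) (hσ : 1 ≤ σ₀)
    (hdim : Module.finrank (ZMod p) V = 2 * σ₀)
    (B : LinearMap.BilinForm (ZMod p) V)
    (hsymm : B.IsSymm) (hnd : B.Nondegenerate)
    (hnn : ∀ W : Submodule (ZMod p) V,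
      (∀ x ∈ W, ∀ y ∈ W, B x y = 0) → Module.finrank (ZMod p) W ≠ σ₀)
    (K : Submodule k (k ⊗[ZMod p] V))
    (hK : IsStrictlyCharacteristicSub p k V σ₀ B K)
    (e : k ⊗[ZMod p] V)
    (hgen : Submodule.span k {e} = lK p k V σ₀ K)
    (hnorm : bcForm p k V B e ((⇑(frobT p k V))^[σ₀] e) = 1)
    (m : ℕ)
    (hm : m = sSup {m' : ℕ | 0 < m' ∧ m' ∣ σ₀ ∧ Odd (σ₀ / m') ∧
      ∀ i : ℕ, 1 ≤ i → i ≤ σ₀ - 1 → ¬ (2 * m' ∣ i) →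
        bcForm p k V B e ((⇑(frobT p k V))^[σ₀ + i] e) = 0})
    :
    Nat.card {s : Set V // ∃ v : V, (v ≠ 0 ∧ B v v = 0) ∧
        s = {w : V | ∃ g ∈ OK p k V B K, g v = w}}
      = (p ^ σ₀ + 1) * (p ^ (σ₀ - 1) - 1) / (p ^ m + 1) := by
  have he : e ∈ lK p k V σ₀ K := hgen ▸ Submodule.mem_span_singleton_self e
  have hgood : GoodVec σ₀ B e := ⟨hsymm, hσ, hdim, form_e_zero hK.1.1 he, hnorm⟩
  have hcard : Nat.card (OK p k V B K) = p ^ m + 1 := by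
    rw [hgood.card_OK hodd hK.1.2.1 hgen, scalarSet_eq p hodd k σ₀ hσ _ m hm]
    exact card_scalarSet p hodd k m
  have horb := card_orbits (OK p k V B K) (fun v => v ≠ 0 ∧ B v v = 0)
    (fun g hg v hv => ⟨by simpa using hv.1, by rw [hg.1]; exact hv.2⟩)
    (fun g hg v hv hgv => by
      obtain ⟨l, hl⟩ := OK_eig hgen g hg
      have := hgood.free (g : V →ₗ[ZMod p] V) hl v hv.1 hgv
      exact LinearEquiv.toLinearMap_injective this)
  have hcount : Nat.card {v : V // v ≠ 0 ∧ B v v = 0} = (p ^ σ₀ + 1) * (p ^ (σ₀ - 1) - 1) := by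
    obtain ⟨n, rfl⟩ : ∃ n, σ₀ = n + 1 := ⟨σ₀ - 1, by omega⟩
    have hc := count_isotropic p hodd n V hdim B hsymm hnd hnn
    have : Module.Finite (ZMod p) V := Module.finite_of_finrank_pos (by omega)
    have : Finite V := Module.finite_of_finite (ZMod p)
    have h1 : Nat.card {v : V // B v v = 0} = Nat.card {v : V // v ≠ 0 ∧ B v v = 0} + 1 := by
      have e1 : {v : V // v ≠ 0 ∧ B v v = 0} = ({v : V | B v v = 0} \ {0} : Set V) := by
        congr 1
        ext v
        simp [and_comm]
      have e2 : Nat.card {v : V // B v v = 0} = ({v : V | B v v = 0} : Set V).ncard := rfl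
      rw [e1, e2]
      exact (Set.ncard_sdiff_singleton_add_one (by simp) (Set.toFinite _)).symm
    rw [h1] at hc
    obtain ⟨q, hq⟩ : ∃ q, p ^ n = q + 1 :=
      ⟨p ^ n - 1, by have := pow_pos (Fact.out : p.Prime).pos n; omega⟩
    rw [show p ^ (2 * n + 1) = p ^ n * p ^ n * p by ring, show p ^ (n + 1) = p ^ n * p by ring,
      hq] at hc
    rw [show p ^ (n + 1) = p ^ n * p by ring, Nat.add_sub_cancel, hq, Nat.add_sub_cancel]
    nlinarith [hc]
  rw [← hcount, ← horb, hcard]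
  exact (Nat.mul_div_cancel _ (by omega)).symm
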